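/- In any triangulation of the polytope R_m (the convex hull of a convex m-gon Q_m together with a segment v_1v_2 parallel to the plane of Q_m whose endpoints project to the interior of Q_m), the number of tetrahedra equals m - 2 + |Γ|, where Γ is the link of the edge v_1v_2, which is a monotone path of edges in an induced triangulation of Q_m. -/

import Mathlib

open Set MeasureTheory
open scoped Classical

noncomputable section

abbrev Pt3 := Fin 3 → ℝ

/-- A (geometric) tetrahedron: 4 affinely independent points. -/
def IsTet (σ : Finset Pt3) : Prop :=
  σ.card = 4 ∧ AffineIndependent ℝ (fun p : (σ : Set Pt3) => (p : Pt3))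

/-- A dissection of the convex polytope `conv V` using only vertices in `V`:
tetrahedra with pairwise disjoint interiors covering the polytope. -/
def IsDissection (V : Finset Pt3) (D : Finset (Finset Pt3)) : Prop :=
  (∀ σ ∈ D, IsTet σ ∧ (σ : Set Pt3) ⊆ (V : Set Pt3)) ∧
  (∀ σ ∈ D, ∀ τ ∈ D, σ ≠ τ →
    interior (convexHull ℝ (σ : Set Pt3)) ∩ interior (convexHull ℝ (τ : Set Pt3)) = ∅) ∧
  (⋃ σ ∈ D, convexHull ℝ (σ : Set Pt3)) = convexHull ℝ (V : Set Pt3)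

/-- A triangulation: a dissection in which any two tetrahedra meet in a common
(possibly empty) face. -/
def IsTriangulation (V : Finset Pt3) (D : Finset (Finset Pt3)) : Prop :=
  IsDissection V D ∧
  ∀ σ ∈ D, ∀ τ ∈ D,
    convexHull ℝ (σ : Set Pt3) ∩ convexHull ℝ (τ : Set Pt3)
      = convexHull ℝ ((σ ∩ τ : Finset Pt3) : Set Pt3)


lemma face_lemma (S : Finset Pt3) (l : Pt3 →ₗ[ℝ] ℝ) (k : ℝ) (hS : ∀ y ∈ S, k ≤ l y)
    (x : Pt3) (hx : x ∈ convexHull ℝ (S : Set Pt3)) (hlx : l x = k) :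
    x ∈ convexHull ℝ ((S.filter (fun y => l y = k) : Finset Pt3) : Set Pt3) := by
  rw [Finset.mem_convexHull'] at hx ⊢
  obtain ⟨w, hw, hw1, hwx⟩ := hx
  have hsum : ∑ y ∈ S, w y * (l y - k) = 0 := by
    have : l x = ∑ y ∈ S, w y * l y := by rw [← hwx]; simp
    simp only [mul_sub, Finset.sum_sub_distrib, ← Finset.sum_mul]
    rw [← this, hw1, hlx]; ring
  have hz := (Finset.sum_eq_zero_iff_of_nonneg
    (fun y hy => mul_nonneg (hw y hy) (sub_nonneg.2 (hS y hy)))).1 hsum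
  have hz' : ∀ y ∈ S, ¬ (l y = k) → w y = 0 := by
    intro y hy hne
    rcases mul_eq_zero.1 (hz y hy) with h | h
    · exact h
    · exact absurd (by linarith) hne
  refine ⟨w, fun y hy => hw y (Finset.mem_filter.1 hy).1, ?_, ?_⟩
  · rw [← hw1, Finset.sum_filter]
    refine Finset.sum_congr rfl fun y hy => ?_
    split_ifs with h
    · rfl
    · exact (hz' y hy h).symm
  · rw [← hwx, Finset.sum_filter]
    refine Finset.sum_congr rfl fun y hy => ?_
    split_ifs with h
    · rfl
    · rw [hz' y hy h, zero_smul]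

lemma exists_functional (Q : Finset Pt3) (hplane : ∀ q ∈ Q, q 2 = 0) :
    ∃ (f : Pt3 →ₗ[ℝ] ℝ) (u : Pt3), u ≠ 0 ∧ f u = 0 ∧ u 2 = 0 ∧
      (∀ x y : Pt3, x 2 = 0 → y 2 = 0 → f x = f y → ∃ t : ℝ, x = y + t • u) ∧
      (∀ x ∈ Q, ∀ y ∈ Q, f x = f y → x = y) := by
  obtain ⟨c, hc⟩ := Infinite.exists_notMem_finset
    ((Q ×ˢ Q).image (fun p : Pt3 × Pt3 => -(p.1 0 - p.2 0) / (p.1 1 - p.2 1)))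
  refine ⟨LinearMap.proj 0 + c • LinearMap.proj 1, ![-c, 1, 0], ?_, ?_, ?_, ?_, ?_⟩
  · intro h
    have := congrFun h 1
    simp at this
  · simp
  · simp
  · intro x y hx hy h
    simp at h
    refine ⟨x 1 - y 1, ?_⟩
    ext i
    fin_cases i
    · simp; linarith
    · simp
    · simp [hx, hy]
  · intro x hx y hy h
    simp at h
    have h1 : x 1 = y 1 := by
      by_contra hne
      apply hc
      rw [Finset.mem_image]
      refine ⟨(x, y), Finset.mem_product.2 ⟨hx, hy⟩, ?_⟩
      have : x 1 - y 1 ≠ 0 := sub_ne_zero.2 hne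
      field_simp
      linarith
    ext i
    fin_cases i
    · simp; rw [h1] at h; linarith
    · simpa using h1
    · simp [hplane x hx, hplane y hy]

/-- the direction into the polygon at a middle vertex -/
lemma exists_dir (Q : Finset Pt3) (hplane : ∀ q ∈ Q, q 2 = 0)
    (hconv : ∀ q ∈ Q, q ∉ convexHull ℝ ((Q.erase q : Finset Pt3) : Set Pt3))
    (f : Pt3 →ₗ[ℝ] ℝ) (u : Pt3) (hu0 : u ≠ 0) (hfu : f u = 0) (hu2 : u 2 = 0)
    (hf : ∀ x y : Pt3, x 2 = 0 → y 2 = 0 → f x = f y → ∃ t : ℝ, x = y + t • u)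
    (q : Pt3) (hq : q ∈ Q) :
    ∃ d : Pt3, d ≠ 0 ∧ f d = 0 ∧ d 2 = 0 ∧
      ∀ a ∈ Q, ∀ c ∈ Q, f a < f q → f q < f c →
        ∃ t : ℝ, 0 < t ∧ ∃ s : ℝ, 0 < s ∧ s < 1 ∧ AffineMap.lineMap a c s = q + t • d := by
  have key : ∀ a ∈ Q, ∀ c ∈ Q, f a < f q → f q < f c →
      ∃ t : ℝ, t ≠ 0 ∧ ∃ s : ℝ, 0 < s ∧ s < 1 ∧ AffineMap.lineMap a c s = q + t • u ∧
        q + t • u ∈ convexHull ℝ ((Q.erase q : Finset Pt3) : Set Pt3) := by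
    intro a ha c hc h1 h2
    have hac : 0 < f c - f a := by linarith
    set s := (f q - f a) / (f c - f a) with hs
    have hs0 : 0 < s := div_pos (by linarith) hac
    have hs1 : s < 1 := by rw [hs, div_lt_one hac]; linarith
    obtain ⟨t, ht⟩ := hf (AffineMap.lineMap a c s) q
      (by simp [AffineMap.lineMap_apply, hplane a ha, hplane c hc]) (hplane q hq)
      (by simp [AffineMap.lineMap_apply]; rw [hs]; field_simp; ring)
    have hmem : q + t • u ∈ convexHull ℝ ((Q.erase q : Finset Pt3) : Set Pt3) := by
      rw [← ht]
      have haq : a ∈ convexHull ℝ ((Q.erase q : Finset Pt3) : Set Pt3) :=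
        subset_convexHull _ _ (by
          simp only [Finset.coe_erase, Set.mem_sdiff, Finset.mem_coe, Set.mem_singleton_iff]
          exact ⟨ha, by rintro rfl; exact lt_irrefl _ h1⟩)
      have hcq : c ∈ convexHull ℝ ((Q.erase q : Finset Pt3) : Set Pt3) :=
        subset_convexHull _ _ (by
          simp only [Finset.coe_erase, Set.mem_sdiff, Finset.mem_coe, Set.mem_singleton_iff]
          exact ⟨hc, by rintro rfl; exact lt_irrefl _ h2⟩)
      exact (convex_convexHull ℝ _).lineMap_mem haq hcq ⟨hs0.le, hs1.le⟩
    refine ⟨t, ?_, s, hs0, hs1, ht, hmem⟩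
    rintro rfl
    apply hconv q hq
    simpa using hmem
  by_cases hpos : ∃ a ∈ Q, ∃ c ∈ Q, f a < f q ∧ f q < f c ∧
      ∃ t : ℝ, t < 0 ∧ q + t • u ∈ convexHull ℝ ((Q.erase q : Finset Pt3) : Set Pt3)
  · obtain ⟨a, ha, c, hc, h1, h2, t, ht, hmem⟩ := hpos
    refine ⟨-u, neg_ne_zero.2 hu0, by simp [hfu], by simp [hu2], ?_⟩
    intro a' ha' c' hc' h1' h2'
    obtain ⟨t', ht', s, hs0, hs1, he, hmem'⟩ := key a' ha' c' hc' h1' h2'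
    refine ⟨-t', ?_, s, hs0, hs1, by rw [he]; simp⟩
    by_contra hcon
    have ht'' : 0 < t' := lt_of_le_of_ne (by linarith) (Ne.symm ht')
    apply hconv q hq
    have h3 := (convex_convexHull ℝ _).lineMap_mem hmem hmem'
      (t := -t / (t' - t)) ⟨div_nonneg (by linarith) (by linarith), by
        rw [div_le_one (by linarith)]; linarith⟩
    have h4 : AffineMap.lineMap (q + t • u) (q + t' • u) (-t / (t' - t)) = q := by
      have hne : t' - t ≠ 0 := by linarith
      ext i
      simp [AffineMap.lineMap_apply]
      field_simp
      ring
    rwa [h4] at h3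
  · refine ⟨u, hu0, hfu, hu2, ?_⟩
    intro a' ha' c' hc' h1' h2'
    obtain ⟨t', ht', s, hs0, hs1, he, hmem'⟩ := key a' ha' c' hc' h1' h2'
    refine ⟨t', ?_, s, hs0, hs1, he⟩
    by_contra hcon
    exact hpos ⟨a', ha', c', hc', h1', h2', t',
      lt_of_le_of_ne (not_lt.1 hcon) ht', hmem'⟩

/-- the affine basis of a tetrahedron -/
def tetBasis (σ : Finset Pt3) (h : IsTet σ) : AffineBasis (σ : Set Pt3) ℝ Pt3 :=
  ⟨fun p => (p : Pt3), h.2, by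
    rw [h.2.affineSpan_eq_top_iff_card_eq_finrank_add_one]
    simp [h.1]⟩

lemma tetBasis_apply (σ : Finset Pt3) (h : IsTet σ) (i : (σ : Set Pt3)) :
    tetBasis σ h i = (i : Pt3) := rfl

lemma tet_height (σ : Finset Pt3) (h : IsTet σ) (v : Pt3) (hv : v ∈ σ)
    (h0 : ∀ y ∈ σ, y ≠ v → y 2 = 0) (x : Pt3) :
    (tetBasis σ h).coord ⟨v, hv⟩ x * v 2 = x 2 := by
  have := congrFun ((tetBasis σ h).linear_combination_coord_eq_self x) 2
  rw [Finset.sum_apply, Finset.sum_eq_single (⟨v, hv⟩ : (σ : Set Pt3))] at this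
  · exact this
  · intro b _ hb
    have : (b : Pt3) 2 = 0 := h0 b b.2 (fun hh => hb (Subtype.ext hh))
    rw [Pi.smul_apply, tetBasis_apply, this, smul_zero]
  · simp

lemma tet_not_flat (σ : Finset Pt3) (h : IsTet σ) : ∃ y ∈ σ, y 2 ≠ 0 := by
  by_contra hcon
  push Not at hcon
  have := congrFun ((tetBasis σ h).linear_combination_coord_eq_self (fun _ => 1)) 2
  rw [Finset.sum_apply, Finset.sum_eq_zero] at this
  · simp at this
  · intro b _
    have : (b : Pt3) 2 = 0 := hcon b b.2
    rw [Pi.smul_apply, tetBasis_apply, this, smul_zero]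

lemma tet_interior (σ : Finset Pt3) (h : IsTet σ) :
    interior (convexHull ℝ (σ : Set Pt3)) = {x | ∀ i, 0 < (tetBasis σ h).coord i x} := by
  rw [← (tetBasis σ h).interior_convexHull]
  congr 2
  exact (Subtype.range_coe (s := (σ : Set Pt3))).symm

open Filter Topology in
lemma eventually_interior (σ : Finset Pt3) (h : IsTet σ) (a q c v w : Pt3)
    (hσ : σ = {a, q, c, v}) (ha : a 2 = 0) (hq : q 2 = 0) (hc : c 2 = 0)
    (hv : 0 < v 2) (hw : 0 < w 2) (haq : a ≠ q) (hac : a ≠ c) (hqc : q ≠ c)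
    (s r : ℝ) (hs0 : 0 < s) (hs1 : s < 1) (hr0 : 0 < r) (hr1 : r < 1) :
    ∀ᶠ ε in 𝓝[>] (0 : ℝ), AffineMap.lineMap (AffineMap.lineMap q (AffineMap.lineMap a c s) r) w ε
      ∈ interior (convexHull ℝ (σ : Set Pt3)) := by
  set p : Pt3 := AffineMap.lineMap q (AffineMap.lineMap a c s) r with hp
  rw [tet_interior σ h]
  simp only [Set.mem_ofPred_eq]
  rw [Filter.eventually_all]
  intro i
  have hvσ : v ∈ σ := by simp [hσ]
  have hva : v ≠ a := by rintro rfl; linarith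
  have hvq : v ≠ q := by rintro rfl; linarith
  have hvc : v ≠ c := by rintro rfl; linarith
  have h0 : ∀ y ∈ σ, y ≠ v → y 2 = 0 := by
    intro y hy hyv
    rw [hσ] at hy
    simp only [Finset.mem_insert, Finset.mem_singleton] at hy
    rcases hy with rfl | rfl | rfl | rfl
    · exact ha
    · exact hq
    · exact hc
    · exact absurd rfl hyv
  have hp2 : p 2 = 0 := by simp [hp, AffineMap.lineMap_apply, ha, hq, hc]
  by_cases hiv : (i : Pt3) = v
  · have hi : i = ⟨v, hvσ⟩ := Subtype.ext hiv
    subst hi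
    filter_upwards [self_mem_nhdsWithin] with ε hε
    have hε' : (0 : ℝ) < ε := hε
    have h1 := tet_height σ h v hvσ h0 (AffineMap.lineMap p w ε)
    have h2 : (AffineMap.lineMap p w ε : Pt3) 2 = ε * w 2 := by
      simp [AffineMap.lineMap_apply, hp2]
    rw [h2] at h1
    have h3 : 0 < ε * w 2 := mul_pos hε' hw
    rw [← h1] at h3
    exact pos_of_mul_pos_left h3 hv.le
  · have hpos : 0 < (tetBasis σ h).coord i p := by
      have hca : ∀ (y : Pt3) (hy : y ∈ σ), (tetBasis σ h).coord i y
          = if (i : Pt3) = y then 1 else 0 := by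
        intro y hy
        have := (tetBasis σ h).coord_apply i ⟨y, hy⟩
        rw [tetBasis_apply] at this
        rw [this]
        congr 1
        exact propext Subtype.ext_iff
      rw [hp, AffineMap.apply_lineMap, AffineMap.apply_lineMap, hca a (by simp [hσ]),
        hca q (by simp [hσ]), hca c (by simp [hσ])]
      have hi : (i : Pt3) ∈ ({a, q, c, v} : Finset Pt3) := hσ ▸ (show (i : Pt3) ∈ σ from i.2)
      simp only [Finset.mem_insert, Finset.mem_singleton] at hi
      rcases hi with e | e | e | e
      · rw [e]; simp [haq, hac, AffineMap.lineMap_apply]; nlinarith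
      · rw [e]; simp [haq.symm, hqc, AffineMap.lineMap_apply]; nlinarith
      · rw [e]; simp [hac.symm, hqc.symm, AffineMap.lineMap_apply]; nlinarith
      · exact absurd e hiv
    have hcont : Continuous (fun ε : ℝ => (tetBasis σ h).coord i (AffineMap.lineMap p w ε)) :=
      ((tetBasis σ h).coord i).continuous_of_finiteDimensional.comp
        (AffineMap.lineMap_continuous)
    have ht := hcont.tendsto 0
    simp only [AffineMap.lineMap_apply_zero] at ht
    exact (ht.mono_left nhdsWithin_le_nhds).eventually (lt_mem_nhds hpos)

/-- `q` is the middle vertex (w.r.t. `f`) of the part of `σ` in `Q` -/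
def Mid (Q : Finset Pt3) (f : Pt3 →ₗ[ℝ] ℝ) (σ : Finset Pt3) (q : Pt3) : Prop :=
  q ∈ Q ∧ q ∈ σ ∧ ∃ a ∈ Q, a ∈ σ ∧ f a < f q ∧ ∃ c ∈ Q, c ∈ σ ∧ f q < f c

lemma mid_struct (Q : Finset Pt3) (hplane : ∀ q ∈ Q, q 2 = 0) (v₁ v₂ : Pt3)
    (f : Pt3 →ₗ[ℝ] ℝ) (σ : Finset Pt3) (h : IsTet σ)
    (hsub : (σ : Set Pt3) ⊆ ((Q ∪ {v₁, v₂} : Finset Pt3) : Set Pt3)) (q a c : Pt3)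
    (hq : q ∈ Q) (hqσ : q ∈ σ) (ha : a ∈ Q) (haσ : a ∈ σ) (hc : c ∈ Q) (hcσ : c ∈ σ)
    (haq : f a < f q) (hqc : f q < f c) :
    ∃ v, (v = v₁ ∨ v = v₂) ∧ σ = {a, q, c, v} ∧ v 2 ≠ 0 ∧ a ≠ q ∧ a ≠ c ∧ q ≠ c := by
  obtain ⟨v, hv, hv2⟩ := tet_not_flat σ h
  have h1 : a ≠ q := by rintro rfl; exact lt_irrefl _ haq
  have h2 : q ≠ c := by rintro rfl; exact lt_irrefl _ hqc
  have h3 : a ≠ c := by rintro rfl; exact lt_irrefl _ (haq.trans hqc)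
  have hvQ : v ∉ Q := fun hh => hv2 (hplane v hh)
  have hva : a ≠ v := by rintro rfl; exact hvQ ha
  have hvq : q ≠ v := by rintro rfl; exact hvQ hq
  have hvc : c ≠ v := by rintro rfl; exact hvQ hc
  refine ⟨v, ?_, ?_, hv2, h1, h3, h2⟩
  · have := hsub (Finset.mem_coe.2 hv)
    simp only [Finset.coe_union, Set.mem_union, Finset.mem_coe, Finset.mem_insert,
      Finset.mem_singleton] at this
    exact this.resolve_left hvQ
  · symm
    apply Finset.eq_of_subset_of_card_le
    · intro y hy
      simp only [Finset.mem_insert, Finset.mem_singleton] at hy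
      rcases hy with rfl | rfl | rfl | rfl <;> assumption
    · rw [h.1, Finset.card_insert_of_notMem, Finset.card_insert_of_notMem,
        Finset.card_insert_of_notMem, Finset.card_singleton]
      · simp [hvc]
      · simp [h2, hvq]
      · simp [h1, h3, hva]

open Filter Topology in
lemma exists_test_point (Q : Finset Pt3) (hplane : ∀ q ∈ Q, q 2 = 0)
    (hconv : ∀ q ∈ Q, q ∉ convexHull ℝ ((Q.erase q : Finset Pt3) : Set Pt3))
    (v₁ v₂ : Pt3) (hpar : v₁ 2 = v₂ 2) (hside : 0 < v₁ 2)
    (f : Pt3 →ₗ[ℝ] ℝ) (u : Pt3) (hu0 : u ≠ 0) (hfu : f u = 0) (hu2 : u 2 = 0)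
    (hf : ∀ x y : Pt3, x 2 = 0 → y 2 = 0 → f x = f y → ∃ t : ℝ, x = y + t • u)
    (hinj : ∀ x ∈ Q, ∀ y ∈ Q, f x = f y → x = y)
    (T : Finset (Finset Pt3))
    (hT : ∀ σ ∈ T, IsTet σ ∧ (σ : Set Pt3) ⊆ ((Q ∪ {v₁, v₂} : Finset Pt3) : Set Pt3))
    (q : Pt3) (hq : Mid Q f Q q) :
    ∃ P : Pt3, P ∈ convexHull ℝ ((Q ∪ {v₁, v₂} : Finset Pt3) : Set Pt3) ∧
      (∀ σ ∈ T, P ∈ convexHull ℝ (σ : Set Pt3) → Mid Q f σ q) ∧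
      (∀ σ ∈ T, Mid Q f σ q → P ∈ interior (convexHull ℝ (σ : Set Pt3))) := by
  obtain ⟨hqQ, -, a₀, ha₀, -, haq₀, c₀, hc₀, -, hqc₀⟩ := hq
  obtain ⟨d, hd0, hfd, hd2, hd⟩ := exists_dir Q hplane hconv f u hu0 hfu hu2 hf q hqQ
  -- choice of the distance in the plane
  have hclosed : ∀ S : Finset Pt3, IsClosed (convexHull ℝ (S : Set Pt3)) := fun S =>
    (S.finite_toSet.isCompact_convexHull (𝕜 := ℝ)).isClosed
  have hcont : Continuous (fun δ : ℝ => q + δ • d) := by fun_prop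
  have ev1 : ∀ᶠ δ in 𝓝[>] (0 : ℝ),
      q + δ • d ∉ convexHull ℝ ((Q.erase q : Finset Pt3) : Set Pt3) := by
    have ht := hcont.tendsto 0
    simp only [zero_smul, add_zero] at ht
    exact (ht.mono_left nhdsWithin_le_nhds).eventually
      ((hclosed _).isOpen_compl.mem_nhds (hconv q hqQ))
  have ev2 : ∀ᶠ δ in 𝓝[>] (0 : ℝ), ∀ a ∈ Q, ∀ c ∈ Q, f a < f q → f q < f c →
      ∃ r : ℝ, 0 < r ∧ r < 1 ∧ ∃ s : ℝ, 0 < s ∧ s < 1 ∧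
        AffineMap.lineMap q (AffineMap.lineMap a c s) r = q + δ • d := by
    rw [Filter.eventually_all_finset]
    intro a ha
    rw [Filter.eventually_all_finset]
    intro c hc
    by_cases h : f a < f q ∧ f q < f c
    · obtain ⟨t, ht, s, hs0, hs1, he⟩ := hd a ha c hc h.1 h.2
      filter_upwards [Ioo_mem_nhdsGT ht] with δ hδ _ _
      refine ⟨δ / t, div_pos hδ.1 ht, (div_lt_one ht).2 hδ.2, s, hs0, hs1, ?_⟩
      rw [he]
      ext i
      simp [AffineMap.lineMap_apply]
      field_simp
      ring
    · exact Filter.Eventually.of_forall fun δ h1 h2 => absurd ⟨h1, h2⟩ h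
  obtain ⟨δ, hδ1, hδ2, hδ0⟩ := (ev1.and (ev2.and self_mem_nhdsWithin)).exists
  have hδ0' : (0 : ℝ) < δ := hδ0
  set p : Pt3 := q + δ • d with hp
  have hp2 : p 2 = 0 := by simp [hp, hplane q hqQ, hd2]
  have hfp : f p = f q := by simp [hp, hfd]
  have hpq : p ≠ q := by
    intro h
    have : δ • d = 0 := by simpa [hp] using h
    rcases smul_eq_zero.1 this with h | h
    · exact hδ0'.ne' h
    · exact hd0 h
  have hpQ : p ∈ convexHull ℝ (Q : Set Pt3) := by
    obtain ⟨r, hr0, hr1, s, hs0, hs1, he⟩ := hδ2 a₀ ha₀ c₀ hc₀ haq₀ hqc₀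
    rw [← he]
    exact (convex_convexHull ℝ _).lineMap_mem (subset_convexHull _ _ hqQ)
      ((convex_convexHull ℝ _).lineMap_mem (subset_convexHull _ _ ha₀)
        (subset_convexHull _ _ hc₀) ⟨hs0.le, hs1.le⟩) ⟨hr0.le, hr1.le⟩
  have hmid : ∀ σ ∈ T, p ∈ convexHull ℝ (σ : Set Pt3) → Mid Q f σ q := by
    intro σ hσ hpσ
    obtain ⟨htet, hsub⟩ := hT σ hσ
    have hcase : ∀ y ∈ σ, y ∈ Q ∨ y = v₁ ∨ y = v₂ := by
      intro y hy
      have := hsub (Finset.mem_coe.2 hy)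
      simp at this
      tauto
    have hz := face_lemma σ (LinearMap.proj 2) 0 (by
      intro y hy
      simp only [LinearMap.proj_apply]
      rcases hcase y hy with h | rfl | rfl
      · exact (hplane y h).ge
      · exact hside.le
      · rw [← hpar]; exact hside.le) p hpσ (by simpa using hp2)
    set S := σ.filter (fun y => (LinearMap.proj 2 : Pt3 →ₗ[ℝ] ℝ) y = 0) with hS
    have hSQ : ∀ y ∈ S, y ∈ Q ∧ y ∈ σ := by
      intro y hy
      rw [hS, Finset.mem_filter] at hy
      obtain ⟨hy1, hy2⟩ := hy
      simp only [LinearMap.proj_apply] at hy2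
      refine ⟨?_, hy1⟩
      rcases hcase y hy1 with h | rfl | rfl
      · exact h
      · linarith
      · linarith
    have hqS : q ∈ S := by
      by_contra hcon
      apply hδ1
      refine convexHull_mono ?_ hz
      intro y hy
      rw [Finset.mem_coe] at hy ⊢
      exact Finset.mem_erase.2 ⟨by rintro rfl; exact hcon hy, (hSQ y hy).1⟩
    have hsingle : ∀ l : Pt3 →ₗ[ℝ] ℝ, l p = l q → (∀ x ∈ Q, l x = l q → x = q) →
        ∃ y ∈ S, l y < l q := by
      intro l hl hl2
      by_contra hcon
      push Not at hcon
      have h1 := face_lemma S l (l q) hcon p hz hl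
      have h2 : ((S.filter (fun y => l y = l q) : Finset Pt3) : Set Pt3) ⊆ {q} := by
        intro y hy
        rw [Finset.mem_coe, Finset.mem_filter] at hy
        exact hl2 y (hSQ y hy.1).1 hy.2
      have h3 := convexHull_mono (𝕜 := ℝ) h2 h1
      rw [convexHull_singleton] at h3
      exact hpq h3
    obtain ⟨a, haS, ha⟩ := hsingle f hfp (fun x hx h => hinj x hx q hqQ h)
    obtain ⟨c, hcS, hc⟩ := hsingle (-f) (by simp [hfp])
      (fun x hx h => hinj x hx q hqQ (by simpa using h))
    exact ⟨hqQ, (hSQ q hqS).2, a, (hSQ a haS).1, (hSQ a haS).2, ha,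
      c, (hSQ c hcS).1, (hSQ c hcS).2, by simpa using hc⟩
  -- choice of the height
  have ev3 : ∀ᶠ ε in 𝓝[>] (0 : ℝ), ∀ σ ∈ T,
      AffineMap.lineMap p v₁ ε ∈ convexHull ℝ (σ : Set Pt3) → Mid Q f σ q := by
    rw [Filter.eventually_all_finset]
    intro σ hσ
    by_cases h : p ∈ convexHull ℝ (σ : Set Pt3)
    · exact Filter.Eventually.of_forall fun _ _ => hmid σ hσ h
    · have hc : Continuous (fun ε : ℝ => (AffineMap.lineMap p v₁ ε : Pt3)) :=
        AffineMap.lineMap_continuous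
      have ht := hc.tendsto 0
      simp only [AffineMap.lineMap_apply_zero] at ht
      filter_upwards [(ht.mono_left nhdsWithin_le_nhds).eventually
        ((hclosed σ).isOpen_compl.mem_nhds h)] with ε hε hε'
      exact absurd hε' hε
  have ev4 : ∀ᶠ ε in 𝓝[>] (0 : ℝ), ∀ σ ∈ T, Mid Q f σ q →
      AffineMap.lineMap p v₁ ε ∈ interior (convexHull ℝ (σ : Set Pt3)) := by
    rw [Filter.eventually_all_finset]
    intro σ hσ
    by_cases h : Mid Q f σ q
    · obtain ⟨-, hqσ, a, ha, haσ, haq, c, hc, hcσ, hqc⟩ := h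
      obtain ⟨htet, hsub⟩ := hT σ hσ
      obtain ⟨v, hv, he, -, n1, n2, n3⟩ := mid_struct Q hplane v₁ v₂ f σ htet hsub q a c
        hqQ hqσ ha haσ hc hcσ haq hqc
      have hv2 : 0 < v 2 := by
        rcases hv with rfl | rfl
        · exact hside
        · rw [← hpar]; exact hside
      obtain ⟨r, hr0, hr1, s, hs0, hs1, hl⟩ := hδ2 a ha c hc haq hqc
      have := eventually_interior σ htet a q c v v₁ he (hplane a ha) (hplane q hqQ)
        (hplane c hc) hv2 hside n1 n2 n3 s r hs0 hs1 hr0 hr1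
      rw [hl] at this
      filter_upwards [this] with ε hε _ using hε
    · exact Filter.Eventually.of_forall fun _ h' => absurd h' h
  obtain ⟨ε, hε1, hε2, hε3⟩ :=
    (ev3.and (ev4.and (Ioo_mem_nhdsGT (zero_lt_one' ℝ)))).exists
  refine ⟨AffineMap.lineMap p v₁ ε, ?_, hε1, hε2⟩
  refine (convex_convexHull ℝ _).lineMap_mem ?_ ?_ ⟨hε3.1.le, hε3.2.le⟩
  · refine convexHull_mono ?_ hpQ
    intro y hy
    simp only [Finset.coe_union, Set.mem_union]
    exact Or.inl hy
  · exact subset_convexHull _ _ (by simp)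

lemma card_middles (Q : Finset Pt3) (f : Pt3 →ₗ[ℝ] ℝ) (hQ : 3 ≤ Q.card)
    (hinj : ∀ x ∈ Q, ∀ y ∈ Q, f x = f y → x = y) :
    (Q.filter (fun q => Mid Q f Q q)).card = Q.card - 2 := by
  have hne : Q.Nonempty := Finset.card_pos.1 (by omega)
  obtain ⟨a, ha, hamin⟩ := Q.exists_min_image f hne
  obtain ⟨c, hc, hcmax⟩ := Q.exists_max_image f hne
  have hac : a ≠ c := by
    rintro rfl
    obtain ⟨x, hx, hxa⟩ := Finset.exists_mem_ne (s := Q) (by omega) a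
    exact hxa (hinj x hx a ha (le_antisymm (hcmax x hx) (hamin x hx)))
  have heq : Q.filter (fun q => Mid Q f Q q) = (Q.erase a).erase c := by
    ext q
    rw [Finset.mem_filter, Finset.mem_erase, Finset.mem_erase, Mid]
    constructor
    · rintro ⟨hq, -, -, x, hx, -, hxq, y, hy, -, hqy⟩
      refine ⟨?_, ?_, hq⟩
      · rintro rfl; exact absurd (hcmax y hy) (not_le.2 hqy)
      · rintro rfl; exact absurd (hamin x hx) (not_le.2 hxq)
    · rintro ⟨h1, h2, hq⟩
      refine ⟨hq, hq, hq, a, ha, ha, ?_, c, hc, hc, ?_⟩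
      · exact lt_of_le_of_ne (hamin q hq) fun h => h2 (hinj q hq a ha h.symm)
      · exact lt_of_le_of_ne (hcmax q hq) fun h => h1 (hinj q hq c hc h)
  rw [heq, Finset.card_erase_of_mem (Finset.mem_erase.2 ⟨hac.symm, hc⟩),
    Finset.card_erase_of_mem ha]
  omega

/-- In any triangulation of `R_m = conv(Q_m ∪ {v₁, v₂})`, where
`Q_m` is a convex `m`-gon in a plane and `v₁v₂` is a segment parallel to that
plane whose endpoints project to the interior of `Q_m`, the number of tetrahedra
equals `m - 2 + |Γ|`, where `|Γ|` is the number of edges in the link `Γ` of the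
edge `v₁v₂`, i.e. the number of tetrahedra containing both `v₁` and `v₂`. -/
theorem triangulation_of_Rm_card (m : ℕ) (hm : 3 ≤ m)
    (Q : Finset Pt3) (hQcard : Q.card = m)
    -- Q lies in the horizontal plane
    (hplane : ∀ q ∈ Q, q 2 = 0)
    -- convex position: Q is the vertex set of a convex m-gon
    (hconv : ∀ q ∈ Q, q ∉ convexHull ℝ ((Q.erase q : Finset Pt3) : Set Pt3))
    (v₁ v₂ : Pt3) (hne : v₁ ≠ v₂)
    -- the segment v₁v₂ is parallel to the plane of Q, on one side of it
    (hpar : v₁ 2 = v₂ 2) (hside : 0 < v₁ 2)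
    -- the endpoints project to the interior of the polygon
    (hproj₁ : Function.update v₁ 2 0 ∈ intrinsicInterior ℝ (convexHull ℝ (Q : Set Pt3)))
    (hproj₂ : Function.update v₂ 2 0 ∈ intrinsicInterior ℝ (convexHull ℝ (Q : Set Pt3)))
    (T : Finset (Finset Pt3))
    (hT : IsTriangulation (Q ∪ {v₁, v₂}) T) :
    T.card = m - 2 + (T.filter (fun σ => v₁ ∈ σ ∧ v₂ ∈ σ)).card := by
  obtain ⟨⟨hTet, hdisj, hcover⟩, -⟩ := hT
  obtain ⟨f, u, hu0, hfu, hu2, hf, hinj⟩ := exists_functional Q hplane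
  have hcase : ∀ σ ∈ T, ∀ y ∈ σ, y ∈ Q ∨ y = v₁ ∨ y = v₂ := by
    intro σ hσ y hy
    have := (hTet σ hσ).2 (Finset.mem_coe.2 hy)
    simp at this
    tauto
  have hv₁Q : v₁ ∉ Q := fun h => hside.ne' (hplane v₁ h)
  have hv₂Q : v₂ ∉ Q := fun h => hside.ne' (hpar.trans (hplane v₂ h))
  have hex : ∀ q ∈ Q.filter (fun q => Mid Q f Q q), ∃ σ ∈ T, Mid Q f σ q ∧
      ∀ τ ∈ T, Mid Q f τ q → τ = σ := by
    intro q hq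
    obtain ⟨P, hP, h1, h2⟩ := exists_test_point Q hplane hconv v₁ v₂ hpar hside f u hu0 hfu hu2
      hf hinj T hTet q (Finset.mem_filter.1 hq).2
    rw [← hcover] at hP
    simp only [Set.mem_iUnion] at hP
    obtain ⟨σ, hσ, hPσ⟩ := hP
    have hm := h1 σ hσ hPσ
    refine ⟨σ, hσ, hm, ?_⟩
    intro τ hτ hmτ
    by_contra hne'
    have hmem : P ∈ interior (convexHull ℝ (τ : Set Pt3)) ∩
        interior (convexHull ℝ (σ : Set Pt3)) := ⟨h2 τ hτ hmτ, h2 σ hσ hm⟩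
    rw [hdisj τ hτ σ hσ hne'] at hmem
    exact hmem
  choose! g hgT hgM hgU using hex
  have hcard : (Q.filter (fun q => Mid Q f Q q)).card
      = (T.filter (fun σ => ¬ (v₁ ∈ σ ∧ v₂ ∈ σ))).card := by
    apply Finset.card_bij (fun q _ => g q)
    · intro q hq
      refine Finset.mem_filter.2 ⟨hgT q hq, ?_⟩
      rintro ⟨hv1, hv2⟩
      obtain ⟨hqQ, hqσ, a, ha, haσ, haq, c, hc, hcσ, hqc⟩ := hgM q hq
      obtain ⟨v, -, he, -⟩ := mid_struct Q hplane v₁ v₂ f _ (hTet _ (hgT q hq)).1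
        (hTet _ (hgT q hq)).2 q a c hqQ hqσ ha haσ hc hcσ haq hqc
      have key : ∀ w ∈ g q, w ∉ Q → w = v := by
        intro w hw hwQ
        rw [he] at hw
        simp only [Finset.mem_insert, Finset.mem_singleton] at hw
        rcases hw with rfl | rfl | rfl | rfl
        · exact absurd ha hwQ
        · exact absurd hqQ hwQ
        · exact absurd hc hwQ
        · rfl
      exact hne ((key v₁ hv1 hv₁Q).trans (key v₂ hv2 hv₂Q).symm)
    · intro q hq q' hq' hgg
      obtain ⟨hqQ, hqσ, a, ha, haσ, haq, c, hc, hcσ, hqc⟩ := hgM q hq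
      obtain ⟨v, -, he, hv2, -⟩ := mid_struct Q hplane v₁ v₂ f _ (hTet _ (hgT q hq)).1
        (hTet _ (hgT q hq)).2 q a c hqQ hqσ ha haσ hc hcσ haq hqc
      have h' := hgM q' hq'
      rw [← hgg] at h'
      obtain ⟨hqQ', hqσ', a', ha', haσ', haq', c', hc', hcσ', hqc'⟩ := h'
      have key : ∀ w ∈ g q, w ∈ Q → w = a ∨ w = q ∨ w = c := by
        intro w hw hwQ
        rw [he] at hw
        simp only [Finset.mem_insert, Finset.mem_singleton] at hw
        rcases hw with rfl | rfl | rfl | rfl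
        · exact Or.inl rfl
        · exact Or.inr (Or.inl rfl)
        · exact Or.inr (Or.inr rfl)
        · exact absurd (hplane _ hwQ) hv2
      have k1 := key q' hqσ' hqQ'
      have k2 := key a' haσ' ha'
      have k3 := key c' hcσ' hc'
      rcases k1 with rfl | rfl | rfl
      · rcases k2 with rfl | rfl | rfl <;> linarith
      · rfl
      · rcases k3 with rfl | rfl | rfl <;> linarith
    · intro σ hσ
      obtain ⟨hσT, hnb⟩ := Finset.mem_filter.1 hσ
      have h3 : 2 < (σ.filter (fun y => y ∈ Q)).card := by
        have hs := Finset.card_filter_add_card_filter_not (s := σ) (fun y => y ∈ Q)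
        rw [(hTet σ hσT).1.1] at hs
        have h1 : (σ.filter (fun y => ¬ y ∈ Q)).card ≤ 1 := by
          rw [Finset.card_le_one]
          intro x hx y hy
          obtain ⟨hx1, hx2⟩ := Finset.mem_filter.1 hx
          obtain ⟨hy1, hy2⟩ := Finset.mem_filter.1 hy
          rcases (hcase σ hσT x hx1).resolve_left hx2 with rfl | rfl <;>
            rcases (hcase σ hσT y hy1).resolve_left hy2 with rfl | rfl
          · rfl
          · exact absurd ⟨hx1, hy1⟩ hnb
          · exact absurd ⟨hy1, hx1⟩ hnb
          · rfl
        omega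
      have hMid : ∃ q, Mid Q f σ q := by
        have hne0 : (σ.filter (fun y => y ∈ Q)).Nonempty := Finset.card_pos.1 (by omega)
        have hinj' : ∀ x ∈ σ.filter (fun y => y ∈ Q), ∀ y ∈ σ.filter (fun y => y ∈ Q),
            f x = f y → x = y := fun x hx y hy h =>
          hinj x (Finset.mem_filter.1 hx).2 y (Finset.mem_filter.1 hy).2 h
        have hc := card_middles _ f h3 hinj'
        have hpos : 0 < ((σ.filter (fun y => y ∈ Q)).filter
            (fun q => Mid (σ.filter (fun y => y ∈ Q)) f (σ.filter (fun y => y ∈ Q)) q)).card := by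
          omega
        obtain ⟨q, hq⟩ := Finset.card_pos.1 hpos
        obtain ⟨-, hq1, -, a, ha, -, haq, c, hc, -, hqc⟩ := Finset.mem_filter.1 hq
        rw [Finset.mem_filter] at hq1 ha hc
        exact ⟨q, hq1.2, hq1.1, a, ha.2, ha.1, haq, c, hc.2, hc.1, hqc⟩
      obtain ⟨q, hq⟩ := hMid
      have hqM : q ∈ Q.filter (fun q => Mid Q f Q q) := by
        obtain ⟨hqQ, hqσ, a, ha, haσ, haq, c, hc, hcσ, hqc⟩ := hq
        exact Finset.mem_filter.2 ⟨hqQ, hqQ, hqQ, a, ha, ha, haq, c, hc, hc, hqc⟩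
      exact ⟨q, hqM, (hgU q hqM σ hσT hq).symm⟩
  rw [card_middles Q f (by omega) hinj, hQcard] at hcard
  have hsplit := Finset.card_filter_add_card_filter_not (s := T) (fun σ => v₁ ∈ σ ∧ v₂ ∈ σ)
  omega
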